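/- Let k be a field of characteristic zero and A a commutative unital k-algebra. If a, b lie in the augmentation ideal I = ⊕_{n>0} C_n(A) of the Hochschild chain complex C(A) with shuffle product •, then e^{(1)}(a • b) = 0; in particular I • I ⊆ Ker(e^{(1)}). -/

import Mathlib

/-!
STATEMENT 2: If `a, b` lie in the augmentation ideal `I = ⊕_{n>0} Cₙ(A)` of the Hochschild
chain complex `C(A)` of a commutative unital `k`-algebra `A` (char k = 0), with shuffle
product `•`, then `e^{(1)}(a • b) = 0`; in particular `I • I ⊆ Ker e^{(1)}`.
-/

open TensorProduct DirectSum PiTensorProduct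

noncomputable section

variable (k : Type) [Field k] [CharZero k] (V : Type) [AddCommGroup V] [Module k V]

/-- The `n`-th tensor power `V^{⊗n}`. -/
abbrev TPow (n : ℕ) : Type := ⨂[k] (_ : Fin n), V

/-- The tensor module `T(V) = ⊕_{n≥0} V^{⊗n}`. -/
abbrev TMod : Type := ⨁ n : ℕ, TPow k V n

/-- Inclusion of the weight-`n` component. -/
abbrev incl (n : ℕ) : TPow k V n →ₗ[k] TMod k V := DirectSum.lof k ℕ (TPow k V) n

/-- `σ.(x₁ ⊗ … ⊗ xₙ) = x_{σ⁻¹(1)} ⊗ … ⊗ x_{σ⁻¹(n)}`. -/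
def permAct {n : ℕ} (σ : Equiv.Perm (Fin n)) : TPow k V n →ₗ[k] TPow k V n :=
  (PiTensorProduct.reindex k (fun _ : Fin n => V) σ).toLinearMap

/-- Concatenation `V^{⊗p} ⊗ V^{⊗q} → V^{⊗(p+q)}`. -/
def concat (p q : ℕ) : TPow k V p ⊗[k] TPow k V q →ₗ[k] TPow k V (p + q) :=
  (PiTensorProduct.reindex k (fun _ : Fin p ⊕ Fin q => V) finSumFinEquiv).toLinearMap ∘ₗ
    (PiTensorProduct.tmulEquiv (ι := Fin p) (ι₂ := Fin q) k V).toLinearMap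

/-- `(p,q)`-shuffles: permutations of `Fin (p+q)` increasing on the first `p` and
on the last `q` entries. -/
def IsShuffle (p q : ℕ) (σ : Equiv.Perm (Fin (p + q))) : Prop :=
  ∀ i j : Fin (p + q), i < j → ((j : ℕ) < p ∨ p ≤ (i : ℕ)) → σ i < σ j

/-- The finite set of `(p,q)`-shuffles. -/
def shuffles (p q : ℕ) : Finset (Equiv.Perm (Fin (p + q))) :=
  letI := Classical.decPred (IsShuffle p q)
  Finset.univ.filter (IsShuffle p q)

/-- The component `sh_{p,q}` of the (signed, graded) shuffle product. -/
def shMul (p q : ℕ) : TPow k V p ⊗[k] TPow k V q →ₗ[k] TPow k V (p + q) :=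
  ∑ σ ∈ shuffles p q,
    (((Equiv.Perm.sign σ : ℤ) : k)) • (permAct k V σ ∘ₗ concat k V p q)

/-- The shuffle product `μ_sh` as a bilinear map on `T(V)`. -/
def mulBil : TMod k V →ₗ[k] TMod k V →ₗ[k] TMod k V :=
  DirectSum.toModule k ℕ (TMod k V →ₗ[k] TMod k V) fun p =>
    ((DirectSum.toModule k ℕ (TPow k V p →ₗ[k] TMod k V) fun q =>
      (TensorProduct.curry (incl k V (p + q) ∘ₗ shMul k V p q)).flip)).flip

/-- The shuffle product `μ_sh : T(V) ⊗ T(V) → T(V)`. -/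
def mulMap : TMod k V ⊗[k] TMod k V →ₗ[k] TMod k V := TensorProduct.lift (mulBil k V)

/-- Splitting `Fin n ≃ Fin p ⊕ Fin (n-p)` for `p ≤ n`. -/
def splitEquiv (n : ℕ) (p : Fin (n + 1)) : Fin n ≃ (Fin (p : ℕ) ⊕ Fin (n - (p : ℕ))) :=
  (finCongr (Nat.add_sub_cancel' (Nat.lt_succ_iff.mp p.isLt)).symm).trans finSumFinEquiv.symm

/-- Weight-`n` component of the deconcatenation coproduct. -/
def comulComp (n : ℕ) : TPow k V n →ₗ[k] TMod k V ⊗[k] TMod k V :=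
  ∑ p : Fin (n + 1),
    (TensorProduct.map (incl k V (p : ℕ)) (incl k V (n - (p : ℕ)))) ∘ₗ
      (PiTensorProduct.tmulEquiv (ι := Fin (p : ℕ)) (ι₂ := Fin (n - (p : ℕ))) k V).symm.toLinearMap ∘ₗ
      (PiTensorProduct.reindex k (fun _ : Fin n => V) (splitEquiv n p)).toLinearMap

/-- The deconcatenation coproduct `Δ`. -/
def comul : TMod k V →ₗ[k] TMod k V ⊗[k] TMod k V :=
  DirectSum.toModule k ℕ (TMod k V ⊗[k] TMod k V) (comulComp k V)

/-- The counit `ε` : projection onto `V^{⊗0} = k`. -/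
def counit : TMod k V →ₗ[k] k :=
  DirectSum.toModule k ℕ k fun n =>
    match n with
    | 0 => (PiTensorProduct.isEmptyEquiv (Fin 0)).toLinearMap
    | _ + 1 => 0

/-- The unit `1 ∈ V^{⊗0}`. -/
def unitT : TMod k V := incl k V 0 ((PiTensorProduct.isEmptyEquiv (Fin 0)).symm 1)

/-- The map `1ε`, unit of the convolution algebra. -/
def oneEps : TMod k V →ₗ[k] TMod k V :=
  (LinearMap.toSpanSingleton k (TMod k V) (unitT k V)) ∘ₗ counit k V

/-- Convolution product `f ⋆ g = μ_sh ∘ (f ⊗ g) ∘ Δ`. -/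
def conv (f g : TMod k V →ₗ[k] TMod k V) : TMod k V →ₗ[k] TMod k V :=
  mulMap k V ∘ₗ TensorProduct.map f g ∘ₗ comul k V

/-- Convolution powers `f^{⋆n}` (with `f^{⋆0} = 1ε`). -/
def convPow (f : TMod k V →ₗ[k] TMod k V) : ℕ → (TMod k V →ₗ[k] TMod k V)
  | 0 => oneEps k V
  | n + 1 => conv k V f (convPow f n)

/-- `J = id - 1ε`. -/
def J : TMod k V →ₗ[k] TMod k V := LinearMap.id - oneEps k V

/-- The first eulerian idempotent `e^{(1)} = log^⋆(id) = Σ_{n≥1} (-1)^{n+1} J^{⋆n}/n`,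
computed weight-wise (in weight `n` the series truncates at `n`). -/
def euler1 : TMod k V →ₗ[k] TMod k V :=
  DirectSum.toModule k ℕ (TMod k V) fun n =>
    ∑ m ∈ Finset.Icc 1 n,
      ((-1 : k) ^ (m + 1) * (m : k)⁻¹) • (convPow k V (J k V) m ∘ₗ incl k V n)

/-- The augmentation ideal `I = ⊕_{n>0} V^{⊗n}`. -/
def augIdeal : Submodule k (TMod k V) := ⨆ n : ℕ, LinearMap.range (incl k V (n + 1))

/-- The square `I^{•2}` of the augmentation ideal under the shuffle product. -/
def augIdealSq : Submodule k (TMod k V) :=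
  Submodule.span k {z | ∃ x ∈ augIdeal k V, ∃ y ∈ augIdeal k V, z = mulMap k V (x ⊗ₜ[k] y)}


variable (A : Type) [CommRing A] [Algebra k A]

/-- Hochschild chains `C(A) = ⊕_{n≥0} A ⊗ A^{⊗n}`, modelled as `A ⊗ T(A)`. -/
abbrev HChains : Type := A ⊗[k] TMod k A

/-- The shuffle product on Hochschild chains:
`(a₀ ⊗ u) • (b₀ ⊗ v) = (a₀b₀) ⊗ (u •_sh v)`. -/
def mulC : HChains k A ⊗[k] HChains k A →ₗ[k] HChains k A :=
  (TensorProduct.map (LinearMap.mul' k A) (mulMap k A)) ∘ₗ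
    (TensorProduct.tensorTensorTensorComm k A (TMod k A) A (TMod k A)).toLinearMap

/-- The first eulerian idempotent acting on chains, by `eₙ^{(1)} ∈ ℚ[Sₙ]` on the last
`n` tensor factors. -/
def euler1C : HChains k A →ₗ[k] HChains k A :=
  TensorProduct.map LinearMap.id (euler1 k A)

/-- The augmentation ideal `I = ⊕_{n>0} A ⊗ A^{⊗n}` of the Hochschild chains. -/
def augIdealC : Submodule k (HChains k A) :=
  LinearMap.range
    (TensorProduct.map (LinearMap.id : A →ₗ[k] A) (Submodule.subtype (augIdeal k A)))

/-- The square `I^{•2}` of the augmentation ideal under the shuffle product. -/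
def augIdealCSq : Submodule k (HChains k A) :=
  Submodule.span k
    {z | ∃ x ∈ augIdealC k A, ∃ y ∈ augIdealC k A, z = mulC k A (x ⊗ₜ[k] y)}

section ShuffleAlgebra

variable {k V} in
/-- The word `w₁ ⊗ … ⊗ wₙ` as an element of `T(V)`. -/
def word {n : ℕ} (w : Fin n → V) : TMod k V := incl k V n (tprod k w)

/-- Contraction of the first letter of a word with the linear form `f`. -/
def contractFirst (f : Module.Dual k V) : TMod k V →ₗ[k] TMod k V :=
  DirectSum.toModule k ℕ (TMod k V) fun n =>
    match n with
    | 0 => 0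
    | n + 1 => incl k V n ∘ₗ PiTensorProduct.lift
        (LinearMap.uncurryLeft (M := fun _ : Fin (n + 1) => V) (f.smulRight (tprod k)))

/-- The grading involution `x ↦ (-1)^{|x|} x` of `T(V)`. -/
def parity : TMod k V →ₗ[k] TMod k V :=
  DirectSum.toModule k ℕ (TMod k V) fun n => (-1 : k) ^ n • incl k V n

variable {k V}

omit [CharZero k]

theorem TMod.hom_ext {M : Type*} [AddCommMonoid M] [Module k M] {f g : TMod k V →ₗ[k] M}
    (h : ∀ (n : ℕ) (w : Fin n → V), f (word w) = g (word w)) : f = g :=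
  DirectSum.linearMap_ext _ fun n => PiTensorProduct.ext <| MultilinearMap.ext fun w => h n w

theorem word_congr {m n : ℕ} (h : m = n) {v : Fin m → V} {w : Fin n → V}
    (hw : ∀ i, v i = w (Fin.cast h i)) : (word v : TMod k V) = word w := by
  subst h
  exact congrArg word (funext hw)

@[simp]
theorem contractFirst_word_zero (f : Module.Dual k V) (w : Fin 0 → V) :
    contractFirst k V f (word w) = 0 := by
  simp [contractFirst, word]

@[simp]
theorem contractFirst_word_succ (f : Module.Dual k V) {n : ℕ} (w : Fin (n + 1) → V) :
    contractFirst k V f (word w) = f (w 0) • word (Fin.tail w) := by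
  simp [contractFirst, word]

@[simp]
theorem parity_word {n : ℕ} (w : Fin n → V) :
    parity k V (word w) = (-1 : k) ^ n • word w := by
  simp [parity, word]

@[simp]
theorem counit_word_zero (w : Fin 0 → V) : counit k V (word w) = 1 := by
  simp [counit, word]

@[simp]
theorem counit_word_succ {n : ℕ} (w : Fin (n + 1) → V) : counit k V (word w) = 0 := by
  simp [counit, word]

theorem unitT_eq_word (w : Fin 0 → V) : unitT k V = word w := by
  rw [unitT, word]
  congr 1
  rw [LinearEquiv.symm_apply_eq]
  simp

theorem parity_contractFirst (f : Module.Dual k V) :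
    parity k V ∘ₗ contractFirst k V f = -(contractFirst k V f ∘ₗ parity k V) := by
  refine TMod.hom_ext fun n w => ?_
  cases n with
  | zero => simp
  | succ n => simp [pow_succ, smul_smul, mul_comm]

/-- The coproduct of a word is the sum over its deconcatenations. -/
theorem comul_word {n : ℕ} (w : Fin n → V) :
    comul k V (word w) = ∑ p : Fin (n + 1),
      word (fun i : Fin p => w ⟨i, by omega⟩) ⊗ₜ[k]
        word (fun i : Fin (n - p) => w ⟨p + i, by omega⟩) := by
  simp only [comul, word, DirectSum.toModule_lof, comulComp, LinearMap.sum_apply,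
    LinearMap.comp_apply, LinearEquiv.coe_coe, reindex_tprod, tmulEquiv_symm_apply,
    TensorProduct.map_tmul]
  rfl

theorem contractFirst_comul (f : Module.Dual k V) :
    TensorProduct.map (contractFirst k V f) LinearMap.id ∘ₗ comul k V =
      comul k V ∘ₗ contractFirst k V f := by
  refine TMod.hom_ext fun n w => ?_
  cases n with
  | zero => simp [comul_word]
  | succ n =>
    simp only [LinearMap.comp_apply, contractFirst_word_succ, map_smul, comul_word, map_sum,
      TensorProduct.map_tmul, LinearMap.id_apply]
    rw [Fin.sum_univ_succ, Finset.smul_sum]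
    simp only [Fin.val_zero, contractFirst_word_zero, TensorProduct.zero_tmul, zero_add]
    refine Finset.sum_congr rfl fun p _ => ?_
    rw [TensorProduct.smul_tmul']
    congr 1
    · exact contractFirst_word_succ f (n := p) _
    · exact word_congr (by simp) fun i => congrArg w (Fin.ext (by simp; omega))

theorem counit_comul (x : TMod k V) :
    TensorProduct.lid k _ (TensorProduct.map (counit k V) LinearMap.id (comul k V x)) = x := by
  suffices h : (TensorProduct.lid k (TMod k V)).toLinearMap ∘ₗ
      TensorProduct.map (counit k V) LinearMap.id ∘ₗ comul k V = LinearMap.id from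
    LinearMap.congr_fun h x
  refine TMod.hom_ext fun n w => ?_
  simp only [LinearMap.comp_apply, comul_word, map_sum, TensorProduct.map_tmul,
    LinearMap.id_apply, LinearEquiv.coe_coe, TensorProduct.lid_tmul]
  rw [Fin.sum_univ_succ]
  have h (p : Fin n) : counit k V (word fun i : Fin p.succ => w ⟨i, by omega⟩) = 0 :=
    counit_word_succ (n := p) _
  simp only [h, zero_smul, Finset.sum_const_zero, add_zero, Fin.val_zero, counit_word_zero,
    one_smul]
  exact word_congr (by simp) fun i => congrArg w (Fin.ext (by simp))

/-- A permutation of `Fin m` that is increasing on `{i | i < p}` and on `{i | p ≤ i}`. -/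
def BlockIncreasing {m : ℕ} (p : ℕ) (σ : Equiv.Perm (Fin m)) : Prop :=
  ∀ i j : Fin m, i < j → ((j : ℕ) < p ∨ p ≤ (i : ℕ)) → σ i < σ j

open Classical in
/-- The signed sum of all shuffles of the first `p` letters of `w` with the remaining ones. -/
def shuffleSum {m : ℕ} (p : ℕ) (w : Fin m → V) : TMod k V :=
  ∑ σ : Equiv.Perm (Fin m),
    if BlockIncreasing p σ then ((Equiv.Perm.sign σ : ℤ) : k) • word (w ∘ σ.symm) else 0

theorem shuffleSum_congr {p q m n : ℕ} (hpq : p = q) (h : m = n) {v : Fin m → V} {w : Fin n → V}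
    (hw : ∀ i, v i = w (Fin.cast h i)) : (shuffleSum p v : TMod k V) = shuffleSum q w := by
  subst h hpq
  exact congrArg (shuffleSum p) (funext hw)

theorem mulMap_word {p q : ℕ} (u : Fin p → V) (v : Fin q → V) :
    mulMap k V (word u ⊗ₜ[k] word v) = shuffleSum p (Fin.append u v) := by
  classical
  simp only [mulMap, mulBil, word, TensorProduct.lift.tmul, DirectSum.toModule_lof,
    LinearMap.flip_apply, TensorProduct.curry_apply, LinearMap.comp_apply, shMul, concat,
    LinearMap.sum_apply, LinearMap.smul_apply, permAct, LinearEquiv.coe_coe, tmulEquiv_apply,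
    reindex_tprod, map_sum, map_smul, shuffleSum, shuffles]
  rw [Finset.sum_filter]
  refine Finset.sum_congr rfl fun σ _ => ?_
  have key : (fun i => Sum.elim u v (finSumFinEquiv.symm (σ.symm i))) =
      Fin.append u v ∘ σ.symm := by
    funext i
    obtain ⟨j, rfl⟩ := σ.surjective i
    obtain ⟨j, rfl⟩ := finSumFinEquiv.surjective j
    cases j <;> simp
  rw [key]
  congr

/-- The permutation of `Fin (m + 1)` sending `i` to `0` and acting as `ρ` on the other entries. -/
def insertZero {m : ℕ} (i : Fin (m + 1)) (ρ : Equiv.Perm (Fin m)) : Equiv.Perm (Fin (m + 1)) :=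
  Equiv.Perm.decomposeFin.symm (0, ρ) * i.cycleRange

@[simp]
theorem insertZero_self {m : ℕ} (i : Fin (m + 1)) (ρ : Equiv.Perm (Fin m)) :
    insertZero i ρ i = 0 := by
  simp [insertZero]

@[simp]
theorem insertZero_succAbove {m : ℕ} (i : Fin (m + 1)) (ρ : Equiv.Perm (Fin m)) (j : Fin m) :
    insertZero i ρ (i.succAbove j) = (ρ j).succ := by
  simp [insertZero]

@[simp]
theorem insertZero_zero_succ {m : ℕ} (ρ : Equiv.Perm (Fin m)) (j : Fin m) :
    insertZero 0 ρ j.succ = (ρ j).succ := by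
  simpa using insertZero_succAbove 0 ρ j

@[simp]
theorem insertZero_symm_zero {m : ℕ} (i : Fin (m + 1)) (ρ : Equiv.Perm (Fin m)) :
    (insertZero i ρ).symm 0 = i := by
  simp [Equiv.symm_apply_eq]

@[simp]
theorem insertZero_symm_succ {m : ℕ} (i : Fin (m + 1)) (ρ : Equiv.Perm (Fin m)) (j : Fin m) :
    (insertZero i ρ).symm j.succ = i.succAbove (ρ.symm j) := by
  simp [Equiv.symm_apply_eq]

theorem sign_insertZero {m : ℕ} (i : Fin (m + 1)) (ρ : Equiv.Perm (Fin m)) :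
    Equiv.Perm.sign (insertZero i ρ) = (-1) ^ (i : ℕ) * Equiv.Perm.sign ρ := by
  simp [insertZero, Fin.sign_cycleRange, Equiv.Perm.decomposeFin.symm_sign, mul_comm]

theorem insertZero_bijective (m : ℕ) :
    Function.Bijective fun x : Fin (m + 1) × Equiv.Perm (Fin m) => insertZero x.1 x.2 := by
  rw [Fintype.bijective_iff_injective_and_card]
  refine ⟨fun ⟨i, ρ⟩ ⟨j, τ⟩ h => ?_, by simp [Fintype.card_perm, Nat.factorial_succ]⟩
  simp only at h
  obtain rfl : i = j := by rw [← insertZero_symm_zero i ρ, h, insertZero_symm_zero]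
  refine Prod.ext rfl (Equiv.ext fun l => Fin.succ_injective _ ?_)
  rw [← insertZero_succAbove i, ← insertZero_succAbove i, h]

theorem blockIncreasing_insertZero_zero {m p : ℕ} (hp : 0 < p) (ρ : Equiv.Perm (Fin m)) :
    BlockIncreasing p (insertZero 0 ρ) ↔ BlockIncreasing (p - 1) ρ := by
  refine ⟨fun h a b hab hp => ?_, fun h a b hab hp => ?_⟩
  · simpa using h a.succ b.succ (by simpa) (by simp; omega)
  · obtain ⟨b, rfl⟩ := Fin.exists_succ_eq.mpr (Fin.ne_zero_of_lt hab)
    rw [insertZero_zero_succ]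
    induction a using Fin.cases with
    | zero => simp
    | succ a =>
      rw [insertZero_zero_succ, Fin.succ_lt_succ_iff]
      exact h a b (by simpa using hab) (by simp at hp; omega)

theorem blockIncreasing_insertZero_self {m p : ℕ} {i : Fin (m + 1)} (hi : (i : ℕ) = p)
    (ρ : Equiv.Perm (Fin m)) :
    BlockIncreasing p (insertZero i ρ) ↔ BlockIncreasing p ρ := by
  subst hi
  have hval (a : Fin m) : (i.succAbove a : ℕ) = if (a : ℕ) < i then (a : ℕ) else a + 1 := by
    simp only [Fin.succAbove, Fin.lt_def, Fin.val_castSucc]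
    split_ifs <;> simp
  refine ⟨fun h a b hab hp => ?_, fun h a b hab hp => ?_⟩
  · have := h (i.succAbove a) (i.succAbove b) (by simpa)
      (by rw [hval, hval]; split_ifs <;> omega)
    simpa using this
  · have hb : b ≠ i := by rintro rfl; rw [Fin.lt_def] at hab; omega
    obtain ⟨b, rfl⟩ := Fin.exists_succAbove_eq hb
    rw [insertZero_succAbove]
    obtain rfl | ha := eq_or_ne a i
    · simp
    · obtain ⟨a, rfl⟩ := Fin.exists_succAbove_eq ha
      rw [insertZero_succAbove, Fin.succ_lt_succ_iff]
      refine h a b (by simpa using hab) ?_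
      rw [hval, hval] at hp
      split_ifs at hp <;> omega

theorem not_blockIncreasing_insertZero {m p : ℕ} {i : Fin (m + 1)} (hi : i ≠ 0)
    (hip : (i : ℕ) ≠ p) (ρ : Equiv.Perm (Fin m)) :
    ¬ BlockIncreasing p (insertZero i ρ) := by
  intro h
  have hi' : (i : ℕ) ≠ 0 := fun h => hi (Fin.ext h)
  have := h ⟨(i : ℕ) - 1, by omega⟩ i (show (i : ℕ) - 1 < i by omega)
    (show (i : ℕ) < p ∨ p ≤ (i : ℕ) - 1 by omega)
  simp at this

theorem contractFirst_shuffleSum (f : Module.Dual k V) {m : ℕ} (p : ℕ) (w : Fin (m + 1) → V) :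
    contractFirst k V f (shuffleSum p w) =
      (if 0 < p then f (w 0) • shuffleSum (p - 1) (Fin.tail w) else 0) +
      if h : p < m + 1 then
        ((-1) ^ p * f (w ⟨p, h⟩)) • shuffleSum p (w ∘ (⟨p, h⟩ : Fin (m + 1)).succAbove) else 0 := by
  classical
  have hterm (i : Fin (m + 1)) (ρ : Equiv.Perm (Fin m)) :
      contractFirst k V f (word (w ∘ (insertZero i ρ).symm)) =
        f (w i) • word ((w ∘ i.succAbove) ∘ ρ.symm) := by
    rw [contractFirst_word_succ]
    congr 2
    · simp
    · funext j
      simp [Fin.tail]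
  have hsum (i : Fin (m + 1)) :
      ∑ ρ : Equiv.Perm (Fin m), (if BlockIncreasing p (insertZero i ρ) then
        ((Equiv.Perm.sign (insertZero i ρ) : ℤ) : k) •
          f (w i) • word ((w ∘ i.succAbove) ∘ ρ.symm) else 0 : TMod k V) =
      (if i = 0 then if 0 < p then f (w 0) • shuffleSum (p - 1) (Fin.tail w) else 0 else 0) +
      if (i : ℕ) = p then ((-1) ^ p * f (w i)) • shuffleSum p (w ∘ i.succAbove) else 0 := by
    by_cases hi : (i : ℕ) = p
    · have h0 : (if i = 0 then if 0 < p then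
          f (w 0) • shuffleSum (p - 1) (Fin.tail w) else 0 else 0 : TMod k V) = 0 := by
        split_ifs with h1 h2
        · subst h1; simp at hi; omega
        all_goals rfl
      rw [h0, zero_add, if_pos hi, shuffleSum, Finset.smul_sum]
      refine Finset.sum_congr rfl fun ρ _ => ?_
      rw [blockIncreasing_insertZero_self hi, sign_insertZero, hi]
      split_ifs
      · push_cast
        rw [smul_smul, smul_smul]
        congr 1
        ring
      · simp
    · rw [if_neg hi, add_zero]
      split_ifs with h0 hp
      · subst h0
        rw [shuffleSum, Finset.smul_sum]
        refine Finset.sum_congr rfl fun ρ _ => ?_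
        rw [blockIncreasing_insertZero_zero hp, sign_insertZero]
        split_ifs
        · rw [smul_comm]
          simp
          rfl
        · simp
      · subst h0; simp at hi; omega
      · exact Finset.sum_eq_zero fun ρ _ => if_neg (not_blockIncreasing_insertZero h0 hi ρ)
  rw [shuffleSum, map_sum, ← (insertZero_bijective m).sum_comp, Fintype.sum_prod_type]
  simp only [apply_ite (contractFirst k V f), map_smul, map_zero, hterm, hsum]
  rw [Finset.sum_add_distrib]
  congr 1
  · simp
  · split_ifs with h
    · rw [Finset.sum_eq_single ⟨p, h⟩]
      · simp
      · exact fun i _ hi => if_neg fun h' => hi (Fin.ext h')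
      · simp
    · exact Finset.sum_eq_zero fun i _ => if_neg (by omega)

theorem contractFirst_shuffleSum_zero (f : Module.Dual k V) (p : ℕ) (w : Fin 0 → V) :
    contractFirst k V f (shuffleSum p w) = 0 := by
  simp [shuffleSum, apply_ite (contractFirst k V f)]

theorem append_eq_dite {α : Type*} {p q : ℕ} (u : Fin p → α) (v : Fin q → α)
    (i : Fin (p + q)) :
    Fin.append u v i = if h : (i : ℕ) < p then u ⟨i, h⟩ else v ⟨i - p, by omega⟩ := by
  induction i using Fin.addCases with
  | left i => simp
  | right i => simp

theorem shuffleSum_append_tail_left {p q m : ℕ} (h : p + q = m) (u : Fin (p + 1) → V)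
    (v : Fin q → V) (w : Fin (m + 1) → V)
    (hw : ∀ i, Fin.append u v i = w (Fin.cast (by omega) i)) :
    (shuffleSum p (Fin.append (Fin.tail u) v) : TMod k V) = shuffleSum p (Fin.tail w) := by
  refine shuffleSum_congr rfl h fun i => ?_
  have := hw ⟨i + 1, by omega⟩
  simp only [append_eq_dite] at this ⊢
  simp only [Fin.tail]
  refine Eq.trans ?_ this
  by_cases hi : (i : ℕ) < p
  · simp [hi]
  · simp [hi, Nat.add_sub_add_right]

theorem shuffleSum_append_tail_right {p q m : ℕ} (h : p + q = m) (u : Fin p → V)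
    (v : Fin (q + 1) → V) (w : Fin (m + 1) → V)
    (hw : ∀ i, Fin.append u v i = w (Fin.cast (by omega) i)) :
    (shuffleSum p (Fin.append u (Fin.tail v)) : TMod k V) =
      shuffleSum p (w ∘ (⟨p, by omega⟩ : Fin (m + 1)).succAbove) := by
  refine shuffleSum_congr rfl h fun i => ?_
  by_cases hi : (i : ℕ) < p
  · have := hw ⟨i, by omega⟩
    simp only [append_eq_dite, dif_pos hi] at this ⊢
    rw [this]
    refine congrArg w (Fin.ext ?_)
    simp [Fin.succAbove, Fin.lt_def, hi]
  · have := hw ⟨i + 1, by omega⟩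
    simp only [append_eq_dite, dif_neg hi, dif_neg (show ¬ (i : ℕ) + 1 < p by omega)] at this ⊢
    simp only [Fin.tail]
    refine Eq.trans (congrArg v (Fin.ext ?_)) (this.trans (congrArg w (Fin.ext ?_)))
    · simp; omega
    · simp [Fin.succAbove, Fin.lt_def, hi]

theorem contractFirst_mulMap_word (f : Module.Dual k V) {p q : ℕ} (u : Fin p → V)
    (v : Fin q → V) :
    contractFirst k V f (mulMap k V (word u ⊗ₜ[k] word v)) =
      mulMap k V (contractFirst k V f (word u) ⊗ₜ[k] word v) +
        mulMap k V (parity k V (word u) ⊗ₜ[k] contractFirst k V f (word v)) := by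
  obtain h | ⟨m, h⟩ : p + q = 0 ∨ ∃ m, p + q = m + 1 := by cases h : p + q <;> simp
  · obtain rfl : p = 0 := by omega
    obtain rfl : q = 0 := by omega
    rw [mulMap_word]
    simpa using contractFirst_shuffleSum_zero f 0 (Fin.append u v)
  · let w : Fin (m + 1) → V := Fin.append u v ∘ Fin.cast h.symm
    have hw (i) : Fin.append u v i = w (Fin.cast h i) := rfl
    rw [mulMap_word, shuffleSum_congr rfl h hw, contractFirst_shuffleSum]
    congr 1
    · cases p with
      | zero => simp
      | succ p =>
        have h0 : w 0 = u 0 := by simp [w, append_eq_dite]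
        simp only [contractFirst_word_succ, ← TensorProduct.smul_tmul', map_smul, mulMap_word,
          shuffleSum_append_tail_left (by omega : p + q = m) u v w hw, h0]
        simp
    · cases q with
      | zero => simp; omega
      | succ q =>
        have h0 : w ⟨p, by omega⟩ = v 0 := by simp [w, append_eq_dite]
        simp only [contractFirst_word_succ, TensorProduct.tmul_smul, map_smul, parity_word,
          ← TensorProduct.smul_tmul', mulMap_word,
          shuffleSum_append_tail_right (by omega : p + q = m) u v w hw]
        rw [dif_pos (by omega), h0, smul_smul, mul_comm]

theorem counit_mulMap_word {p q : ℕ} (u : Fin p → V) (v : Fin q → V) :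
    counit k V (mulMap k V (word u ⊗ₜ[k] word v)) =
      counit k V (word u) * counit k V (word v) := by
  rw [mulMap_word]
  obtain h | ⟨m, h⟩ : p + q = 0 ∨ ∃ m, p + q = m + 1 := by cases h : p + q <;> simp
  · obtain rfl : p = 0 := by omega
    obtain rfl : q = 0 := by omega
    simp [shuffleSum, BlockIncreasing]
  · have hw : (shuffleSum p (Fin.append u v) : TMod k V) =
        shuffleSum p (Fin.append u v ∘ Fin.cast h.symm) := shuffleSum_congr rfl h fun _ => rfl
    rw [hw]
    have : counit k V (word u) * counit k V (word v) = 0 := by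
      cases p with
      | zero =>
        obtain rfl : q = m + 1 := by omega
        simp
      | succ p => simp
    simp [this, shuffleSum, apply_ite (counit k V)]

/-- Contraction of the first letter is a graded derivation of the shuffle product. -/
theorem contractFirst_mulMap (f : Module.Dual k V) (x y : TMod k V) :
    contractFirst k V f (mulMap k V (x ⊗ₜ[k] y)) =
      mulMap k V (contractFirst k V f x ⊗ₜ[k] y) +
        mulMap k V (parity k V x ⊗ₜ[k] contractFirst k V f y) := by
  let μ := TensorProduct.mk k (TMod k V) (TMod k V) |>.compr₂ (mulMap k V)
  suffices h : μ.compr₂ (contractFirst k V f) =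
      μ ∘ₗ contractFirst k V f + (μ ∘ₗ parity k V).compl₂ (contractFirst k V f) from
    LinearMap.congr_fun₂ h x y
  exact TMod.hom_ext fun _ u => TMod.hom_ext fun _ v => contractFirst_mulMap_word f u v

theorem counit_mulMap (x y : TMod k V) :
    counit k V (mulMap k V (x ⊗ₜ[k] y)) = counit k V x * counit k V y := by
  let μ := TensorProduct.mk k (TMod k V) (TMod k V) |>.compr₂ (mulMap k V)
  suffices h : μ.compr₂ (counit k V) =
      (LinearMap.mul k k ∘ₗ counit k V).compl₂ (counit k V) from
    LinearMap.congr_fun₂ h x y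
  exact TMod.hom_ext fun _ u => TMod.hom_ext fun _ v => counit_mulMap_word u v

section ShuffleCharacter

variable {E : Type} [AddCommGroup E] [Module k E]

open CliffordAlgebra (contractLeft)

/-- The time-ordered product of the factors `1 + fᵢ ⊗ eᵢ`, as an algebra morphism from the
shuffle algebra to an exterior algebra. -/
def shuffleChar : List (Module.Dual k V × E) → TMod k V →ₗ[k] ExteriorAlgebra k E
  | [] => Algebra.linearMap k (ExteriorAlgebra k E) ∘ₗ counit k V
  | (f, e) :: X => shuffleChar X +
      LinearMap.mulLeft k (ExteriorAlgebra.ι k e) ∘ₗ shuffleChar X ∘ₗ contractFirst k V f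

theorem shuffleChar_nil (x : TMod k V) :
    shuffleChar ([] : List (Module.Dual k V × E)) x = algebraMap k _ (counit k V x) := rfl

theorem shuffleChar_cons (f : Module.Dual k V) (e : E) (X : List (Module.Dual k V × E))
    (x : TMod k V) :
    shuffleChar ((f, e) :: X) x =
      shuffleChar X x + ExteriorAlgebra.ι k e * shuffleChar X (contractFirst k V f x) := rfl

theorem counit_parity (x : TMod k V) : counit k V (parity k V x) = counit k V x := by
  suffices h : counit k V ∘ₗ parity k V = counit k V from LinearMap.congr_fun h x
  refine TMod.hom_ext fun n w => ?_
  cases n <;> simp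

theorem ι_mul_ι_swap (a b : E) :
    ExteriorAlgebra.ι k a * ExteriorAlgebra.ι k b =
      -(ExteriorAlgebra.ι k b * ExteriorAlgebra.ι k a) :=
  eq_neg_of_add_eq_zero_left (ExteriorAlgebra.ι_add_mul_swap a b)

theorem shuffleChar_mul_ι (X : List (Module.Dual k V × E)) (e : E) (x : TMod k V) :
    shuffleChar X x * ExteriorAlgebra.ι k e =
      ExteriorAlgebra.ι k e * shuffleChar X (parity k V x) := by
  induction X generalizing x with
  | nil => simp only [shuffleChar_nil, counit_parity, Algebra.commutes]
  | cons X₀ X ih =>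
    obtain ⟨f, e'⟩ := X₀
    have h : contractFirst k V f (parity k V x) = -parity k V (contractFirst k V f x) := by
      rw [eq_neg_iff_add_eq_zero, add_comm, ← eq_neg_iff_add_eq_zero]
      exact LinearMap.congr_fun (parity_contractFirst f) x
    rw [shuffleChar_cons, shuffleChar_cons, h, add_mul, ih, mul_assoc, ih, ← mul_assoc,
      ι_mul_ι_swap, mul_add, map_neg]
    noncomm_ring

theorem shuffleChar_mulMap (X : List (Module.Dual k V × E)) (x y : TMod k V) :
    shuffleChar X (mulMap k V (x ⊗ₜ[k] y)) = shuffleChar X x * shuffleChar X y := by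
  induction X generalizing x y with
  | nil => simp only [shuffleChar_nil, counit_mulMap, map_mul]
  | cons X₀ X ih =>
    obtain ⟨f, e⟩ := X₀
    have h : ExteriorAlgebra.ι k e * shuffleChar X (contractFirst k V f x) *
        (ExteriorAlgebra.ι k e * shuffleChar X (contractFirst k V f y)) = 0 := by
      rw [mul_assoc, ← mul_assoc _ (ExteriorAlgebra.ι k e), shuffleChar_mul_ι, ← mul_assoc,
        ← mul_assoc, ExteriorAlgebra.ι_sq_zero, zero_mul, zero_mul]
    simp only [shuffleChar_cons, contractFirst_mulMap, map_add, ih]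
    rw [add_mul, mul_add (shuffleChar X x), mul_add (_ * _), h, ← mul_assoc (shuffleChar X x),
      shuffleChar_mul_ι]
    noncomm_ring

/-- Left convolution with a linear map `g : T(V) → B`. -/
def convLeft {B : Type*} [Ring B] [Algebra k B] (g : TMod k V →ₗ[k] B) :
    Module.End k (TMod k V →ₗ[k] B) where
  toFun h := LinearMap.mul' k B ∘ₗ TensorProduct.map g h ∘ₗ comul k V
  map_add' h h' := by
    rw [TensorProduct.map_add_right, LinearMap.add_comp, LinearMap.comp_add]
  map_smul' c h := by
    rw [TensorProduct.map_smul_right, LinearMap.smul_comp, LinearMap.comp_smul, RingHom.id_apply]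

theorem convLeft_apply {B : Type*} [Ring B] [Algebra k B] (g h : TMod k V →ₗ[k] B) :
    convLeft g h = LinearMap.mul' k B ∘ₗ TensorProduct.map g h ∘ₗ comul k V := rfl

theorem convLeft_sub {B : Type*} [Ring B] [Algebra k B] (g g' : TMod k V →ₗ[k] B) :
    convLeft (g - g') = convLeft g - convLeft g' := by
  ext1 h
  simp only [LinearMap.sub_apply, convLeft_apply]
  have := TensorProduct.map_add_left (g - g') g' h
  rw [sub_add_cancel] at this
  rw [this, LinearMap.add_comp, LinearMap.comp_add, add_sub_cancel_right]

theorem convLeft_shuffleChar_nil :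
    convLeft (shuffleChar ([] : List (Module.Dual k V × E))) = 1 := by
  ext1 h
  rw [Module.End.one_apply, convLeft_apply]
  have : LinearMap.mul' k (ExteriorAlgebra k E) ∘ₗ
      TensorProduct.map (shuffleChar ([] : List (Module.Dual k V × E))) h =
      h ∘ₗ (TensorProduct.lid k (TMod k V)).toLinearMap ∘ₗ
        TensorProduct.map (counit k V) LinearMap.id := by
    refine TensorProduct.ext' fun x y => ?_
    simp [shuffleChar_nil, ← Algebra.smul_def]
  rw [← LinearMap.comp_assoc, this]
  exact LinearMap.ext fun x => congrArg h (counit_comul x)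

/-- Concatenation of the data turns into convolution of the associated characters. -/
theorem shuffleChar_append (X Y : List (Module.Dual k V × E)) :
    shuffleChar (X ++ Y) = convLeft (shuffleChar X) (shuffleChar Y) := by
  induction X with
  | nil => rw [convLeft_shuffleChar_nil]; rfl
  | cons X₀ X ih =>
    obtain ⟨f, e⟩ := X₀
    rw [List.cons_append, shuffleChar, ih, shuffleChar, convLeft_apply, convLeft_apply,
      TensorProduct.map_add_left, LinearMap.add_comp, LinearMap.comp_add]
    congr 1
    have h : LinearMap.mul' k (ExteriorAlgebra k E) ∘ₗ
        TensorProduct.map (LinearMap.mulLeft k (ExteriorAlgebra.ι k e) ∘ₗ shuffleChar X ∘ₗ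
          contractFirst k V f) (shuffleChar Y) =
        LinearMap.mulLeft k (ExteriorAlgebra.ι k e) ∘ₗ LinearMap.mul' k (ExteriorAlgebra k E) ∘ₗ
          TensorProduct.map (shuffleChar X) (shuffleChar Y) ∘ₗ
          TensorProduct.map (contractFirst k V f) LinearMap.id := by
      refine TensorProduct.ext' fun x y => ?_
      simp [mul_assoc]
    rw [LinearMap.comp_assoc, LinearMap.comp_assoc, ← contractFirst_comul]
    exact (congrArg (· ∘ₗ comul k V) h).symm

theorem shuffleChar_comp_conv (X : List (Module.Dual k V × E)) (g h : TMod k V →ₗ[k] TMod k V) :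
    shuffleChar X ∘ₗ conv k V g h = convLeft (shuffleChar X ∘ₗ g) (shuffleChar X ∘ₗ h) := by
  have : shuffleChar X ∘ₗ mulMap k V = LinearMap.mul' k (ExteriorAlgebra k E) ∘ₗ
      TensorProduct.map (shuffleChar X) (shuffleChar X) :=
    TensorProduct.ext' fun x y => by simp [shuffleChar_mulMap]
  rw [conv, ← LinearMap.comp_assoc, this, convLeft_apply, TensorProduct.map_comp]
  rfl

theorem shuffleChar_comp_oneEps (X : List (Module.Dual k V × E)) :
    shuffleChar X ∘ₗ oneEps k V = shuffleChar [] := by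
  have h : shuffleChar X (unitT k V) = 1 := by
    rw [unitT_eq_word Fin.elim0]
    induction X with
    | nil => simp [shuffleChar_nil]
    | cons X₀ X ih =>
      obtain ⟨f, e⟩ := X₀
      simp [shuffleChar_cons, ih]
  refine LinearMap.ext fun x => ?_
  simp [oneEps, shuffleChar_nil, h, Algebra.algebraMap_eq_smul_one]

theorem shuffleChar_comp_convPow_J (X : List (Module.Dual k V × E)) (m : ℕ) :
    shuffleChar X ∘ₗ convPow k V (J k V) m =
      ((convLeft (shuffleChar X) - 1) ^ m) (shuffleChar []) := by
  induction m with
  | zero => exact shuffleChar_comp_oneEps X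
  | succ m ih =>
    rw [convPow, shuffleChar_comp_conv, ih, pow_succ', Module.End.mul_apply, J,
      LinearMap.comp_sub, shuffleChar_comp_oneEps, LinearMap.comp_id, convLeft_sub,
      convLeft_shuffleChar_nil]

theorem shuffleChar_flatten_replicate (X : List (Module.Dual k V × E)) (n : ℕ) :
    shuffleChar (List.replicate n X).flatten =
      (convLeft (shuffleChar X) ^ n) (shuffleChar []) := by
  induction n with
  | zero => rfl
  | succ n ih =>
    rw [List.replicate_succ, List.flatten_cons, shuffleChar_append, ih, pow_succ',
      Module.End.mul_apply]

theorem shuffleChar_flatten_replicate_eq_sum (X : List (Module.Dual k V × E)) (n : ℕ)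
    (x : TMod k V) :
    shuffleChar (List.replicate n X).flatten x =
      ∑ j ∈ Finset.range (n + 1), n.choose j • shuffleChar X (convPow k V (J k V) j x) := by
  have h := (Commute.one_right (convLeft (shuffleChar X) - 1)).add_pow n
  have h' : convLeft (shuffleChar X) - 1 + 1 = convLeft (shuffleChar X) :=
    LinearMap.ext fun g => by simp
  rw [h'] at h
  rw [shuffleChar_flatten_replicate, h, LinearMap.sum_apply, LinearMap.sum_apply]
  refine Finset.sum_congr rfl fun j _ => ?_
  rw [one_pow, mul_one, (Nat.cast_commute _ _).eq.symm, ← nsmul_eq_mul, LinearMap.smul_apply,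
    LinearMap.smul_apply, ← shuffleChar_comp_convPow_J, LinearMap.comp_apply]

/-- Attach distinct generators of an exterior algebra to the linear forms in a list. -/
def tagForms : List (Module.Dual k V) → List (Module.Dual k V × (ℕ →₀ k))
  | [] => []
  | f :: L => (f, Finsupp.single L.length 1) :: tagForms L

theorem contractLeft_shuffleChar_tagForms (L : List (Module.Dual k V)) {n : ℕ}
    (hn : L.length ≤ n) (x : TMod k V) :
    contractLeft (Q := (0 : QuadraticForm k (ℕ →₀ k))) (Finsupp.lapply n)
      (shuffleChar (tagForms L) x) = 0 := by
  induction L generalizing x with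
  | nil => exact CliffordAlgebra.contractLeft_algebraMap (Q := (0 : QuadraticForm k (ℕ →₀ k))) _ _
  | cons f L ih =>
    have hn' : L.length < n := by simpa using hn
    rw [tagForms, shuffleChar_cons, map_add, ih hn'.le, zero_add]
    refine (CliffordAlgebra.contractLeft_ι_mul _ _ _).trans ?_
    rw [ih hn'.le]
    simp [hn'.ne]

theorem shuffleChar_tagForms_contractFirst {x : TMod k V}
    (h : ∀ L, shuffleChar (tagForms L) x = 0) (f : Module.Dual k V) (L : List (Module.Dual k V)) :
    shuffleChar (tagForms L) (contractFirst k V f x) = 0 := by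
  have h1 := congrArg (contractLeft (Q := (0 : QuadraticForm k (ℕ →₀ k)))
    (Finsupp.lapply L.length)) (h (f :: L))
  rw [tagForms, shuffleChar_cons, map_add, contractLeft_shuffleChar_tagForms L le_rfl,
    zero_add, map_zero] at h1
  replace h1 := (CliffordAlgebra.contractLeft_ι_mul _ _ _).symm.trans h1
  rw [contractLeft_shuffleChar_tagForms L le_rfl] at h1
  simpa using h1

theorem counit_apply (x : TMod k V) :
    counit k V x = PiTensorProduct.isEmptyEquiv (Fin 0) (x 0) := by
  suffices h : counit k V = (PiTensorProduct.isEmptyEquiv (Fin 0)).toLinearMap ∘ₗ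
      DirectSum.component k ℕ (TPow k V) 0 from LinearMap.congr_fun h x
  refine TMod.hom_ext fun n w => ?_
  cases n with
  | zero =>
    rw [counit_word_zero]
    simp [word, DirectSum.component.lof_self]
  | succ n =>
    rw [counit_word_succ]
    simp [word, DirectSum.component.of]

theorem repr_contractFirst {κ : Type} (b : Module.Basis κ k V) (j : κ) (n : ℕ) (p : Fin n → κ)
    (x : TMod k V) :
    (Basis.piTensorProduct fun _ : Fin n => b).repr (contractFirst k V (b.coord j) x n) p =
      (Basis.piTensorProduct fun _ : Fin (n + 1) => b).repr (x (n + 1)) (Fin.cons j p) := by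
  let r (n : ℕ) (p : Fin n → κ) : TMod k V →ₗ[k] k := Finsupp.lapply p ∘ₗ
    (Basis.piTensorProduct fun _ : Fin n => b).repr.toLinearMap ∘ₗ
      DirectSum.component k ℕ (TPow k V) n
  have hr (n : ℕ) (p : Fin n → κ) (w : Fin n → V) : r n p (word w) = ∏ i, b.repr (w i) (p i) := by
    simp [r, word, DirectSum.component.lof_self]
  have hr' {m n : ℕ} (h : m ≠ n) (p : Fin n → κ) (w : Fin m → V) : r n p (word w) = 0 := by
    simp [r, word, DirectSum.component.of, h]
  suffices h : r n p ∘ₗ contractFirst k V (b.coord j) = r (n + 1) (Fin.cons j p) from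
    LinearMap.congr_fun h x
  refine TMod.hom_ext fun m w => ?_
  rw [LinearMap.comp_apply]
  cases m with
  | zero => rw [contractFirst_word_zero, map_zero, hr' (by omega)]
  | succ m =>
    rw [contractFirst_word_succ, map_smul]
    obtain rfl | h := eq_or_ne m n
    · rw [hr, hr, Fin.prod_univ_succ]
      simp [Fin.tail]
    · rw [hr' h, hr' (by omega), smul_zero]

/-- The characters `shuffleChar X` separate the points of `T(V)`. -/
theorem eq_zero_of_shuffleChar {x : TMod k V}
    (h : ∀ X : List (Module.Dual k V × (ℕ →₀ k)), shuffleChar X x = 0) : x = 0 := by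
  refine DFinsupp.ext fun n => ?_
  replace h (L) := h (tagForms L)
  let b := Module.Basis.ofVectorSpace k V
  refine (Basis.piTensorProduct fun _ : Fin n => b).ext_elem fun p => ?_
  induction n generalizing x with
  | zero =>
    have h0 : (x 0 : TPow k V 0) = 0 := by
      have := h []
      rw [tagForms, shuffleChar_nil, counit_apply, map_eq_zero_iff _ (algebraMap k _).injective,
        LinearEquiv.map_eq_zero_iff] at this
      exact this
    simp [h0]
  | succ n ih =>
    have := ih (x := contractFirst k V (b.coord (p 0)) x)
      (fun L => shuffleChar_tagForms_contractFirst h _ L) (Fin.tail p)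
    rw [repr_contractFirst, Fin.cons_self_tail] at this
    simpa using this

theorem convPow_J_word {n m : ℕ} (h : n < m) (w : Fin n → V) :
    convPow k V (J k V) m (word w) = 0 := by
  induction m generalizing n with
  | zero => omega
  | succ m ih =>
    simp only [convPow, conv, LinearMap.comp_apply, comul_word, map_sum, TensorProduct.map_tmul]
    refine Finset.sum_eq_zero fun p _ => ?_
    obtain hp | hp := Nat.eq_zero_or_pos (p : ℕ)
    · obtain rfl : p = 0 := Fin.ext hp
      have : J k V (word fun i : Fin (0 : Fin (n + 1)) => w ⟨i, by omega⟩) = 0 := by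
        rw [J, LinearMap.sub_apply, LinearMap.id_apply, sub_eq_zero, oneEps,
          LinearMap.comp_apply]
        refine Eq.trans ?_ (congrArg _ (counit_word_zero _).symm)
        rw [LinearMap.toSpanSingleton_apply, one_smul]
        exact (unitT_eq_word _).symm
      rw [this, TensorProduct.zero_tmul, map_zero]
    · rw [ih (by omega), TensorProduct.tmul_zero, map_zero]

theorem convPow_J_incl {n m : ℕ} (h : n < m) (x : TPow k V n) :
    convPow k V (J k V) m (incl k V n x) = 0 := by
  suffices h : convPow k V (J k V) m ∘ₗ incl k V n = 0 from LinearMap.congr_fun h x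
  exact PiTensorProduct.ext <| MultilinearMap.ext fun w => convPow_J_word h w

theorem shuffleChar_flatten_replicate_incl {E : Type} [AddCommGroup E] [Module k E]
    (X : List (Module.Dual k V × E)) (n : ℕ) {p N : ℕ} (h : p ≤ N) (x : TPow k V p) :
    shuffleChar (List.replicate n X).flatten (incl k V p x) =
      ∑ j ∈ Finset.range (N + 1),
        n.choose j • shuffleChar X (convPow k V (J k V) j (incl k V p x)) := by
  rw [shuffleChar_flatten_replicate_eq_sum]
  have hl : Finset.range (n + 1) ⊆ Finset.range (max n N + 1) :=
    Finset.range_subset_range.mpr (by omega)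
  have hr : Finset.range (N + 1) ⊆ Finset.range (max n N + 1) :=
    Finset.range_subset_range.mpr (by omega)
  rw [Finset.sum_subset hl, Finset.sum_subset hr]
  · intro j _ hj
    rw [Finset.mem_range, not_lt] at hj
    rw [convPow_J_incl (by omega), map_zero, smul_zero]
  · intro j _ hj
    rw [Finset.mem_range, not_lt] at hj
    rw [Nat.choose_eq_zero_of_lt (by omega), zero_smul]

section Binomial

open Polynomial

variable (k) in
/-- The polynomial `X (X - 1) ⋯ (X - j + 1) / j!`. -/
def binomialPoly (j : ℕ) : k[X] := C ((j.factorial : k)⁻¹) * descPochhammer k j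

theorem eval_binomialPoly [CharZero k] (n j : ℕ) : (binomialPoly k j).eval (n : k) = n.choose j := by
  rw [binomialPoly, eval_mul, eval_C, descPochhammer_eval_eq_descFactorial,
    Nat.descFactorial_eq_factorial_mul_choose]
  have : (j.factorial : k) ≠ 0 := by exact_mod_cast j.factorial_ne_zero
  push_cast
  field_simp

theorem coeff_zero_binomialPoly {j : ℕ} (hj : j ≠ 0) : (binomialPoly k j).coeff 0 = 0 := by
  rw [coeff_zero_eq_eval_zero, binomialPoly, eval_mul, descPochhammer_ne_zero_eval_zero _ hj,
    mul_zero]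

theorem eval_neg_one_descPochhammer (j : ℕ) :
    (descPochhammer k j).eval (-1) = (-1) ^ j * j.factorial := by
  induction j with
  | zero => simp
  | succ j ih =>
    rw [descPochhammer_succ_eval, ih, Nat.factorial_succ]
    push_cast
    ring

theorem coeff_one_binomialPoly [CharZero k] {j : ℕ} (hj : j ≠ 0) :
    (binomialPoly k j).coeff 1 = (-1) ^ (j + 1) * (j : k)⁻¹ := by
  obtain ⟨j, rfl⟩ := Nat.exists_eq_succ_of_ne_zero hj
  have h1 : ((j.factorial : ℕ) : k) ≠ 0 := by exact_mod_cast j.factorial_ne_zero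
  have h2 : ((j : k) + 1) ≠ 0 := by exact_mod_cast j.succ_ne_zero
  rw [binomialPoly, coeff_C_mul, descPochhammer_succ_left, coeff_X_mul,
    coeff_zero_eq_eval_zero, eval_comp]
  simp only [eval_sub, eval_X, eval_one, zero_sub, eval_neg_one_descPochhammer,
    Nat.factorial_succ, Nat.succ_eq_add_one]
  push_cast
  field_simp
  ring

/-- If `n ↦ ∑ⱼ (n choose j) cⱼ` is the product of two functions of the same kind without constant
terms, then its linear coefficient vanishes. -/
theorem sum_linear_coeff_eq_zero [CharZero k] {B : Type} [Ring B] [Algebra k B] {N : ℕ}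
    {a b c : ℕ → B}
    (ha : a 0 = 0) (hb : b 0 = 0)
    (h : ∀ n : ℕ, ∑ j ∈ Finset.range (N + 1), n.choose j • c j =
      (∑ j ∈ Finset.range (N + 1), n.choose j • a j) *
        ∑ j ∈ Finset.range (N + 1), n.choose j • b j) :
    ∑ j ∈ Finset.Icc 1 N, ((-1 : k) ^ (j + 1) * (j : k)⁻¹) • c j = 0 := by
  have hc : c 0 = 0 := by
    simpa [Finset.sum_range_succ', ha] using h 0
  rw [← Module.forall_dual_apply_eq_zero_iff k]
  intro φ
  have key : ∑ j ∈ Finset.range (N + 1), C (φ (c j)) * binomialPoly k j =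
      ∑ i ∈ Finset.range (N + 1), ∑ j ∈ Finset.range (N + 1),
        C (φ (a i * b j)) * (binomialPoly k i * binomialPoly k j) := by
    refine eq_of_infinite_eval_eq _ _ (Set.Infinite.mono ?_
      (Set.infinite_range_of_injective (Nat.cast_injective (R := k))))
    rintro _ ⟨n, rfl⟩
    have hn := congrArg φ (h n)
    rw [Finset.sum_mul_sum] at hn
    simp only [map_sum, smul_mul_smul_comm, map_nsmul] at hn
    simp only [Set.mem_ofPred_eq, eval_finsetSum, eval_mul, eval_C, eval_binomialPoly]
    simpa [mul_comm, mul_assoc, mul_left_comm] using hn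
  replace key := congrArg (coeff · 1) key
  simp only [finsetSum_coeff, coeff_C_mul] at key
  rw [Finset.sum_eq_zero (s := Finset.range (N + 1)) (f := fun i => ∑ j ∈ _, _)] at key
  · rw [Finset.sum_range_succ', hc, map_zero, zero_mul, add_zero] at key
    rw [map_sum, ← key, Finset.range_eq_Ico, Finset.sum_Ico_add' (fun j =>
      φ (c j) * (binomialPoly k j).coeff 1) 0 N 1]
    refine Finset.sum_congr (by ext; simp) fun j hj => ?_
    rw [coeff_one_binomialPoly (by simp at hj; omega), map_smul, smul_eq_mul, mul_comm]
  · refine fun i _ => Finset.sum_eq_zero fun j _ => ?_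
    obtain rfl | hi := eq_or_ne i 0
    · simp [ha]
    obtain rfl | hj := eq_or_ne j 0
    · simp [hb]
    simp [mul_coeff_one, coeff_zero_binomialPoly hi, coeff_zero_binomialPoly hj]

end Binomial

theorem euler1_mulMap_incl [CharZero k] {p q : ℕ} (hp : p ≠ 0) (hq : q ≠ 0) (x : TPow k V p)
    (y : TPow k V q) :
    euler1 k V (mulMap k V (incl k V p x ⊗ₜ[k] incl k V q y)) = 0 := by
  obtain ⟨z, hz⟩ : ∃ z, mulMap k V (incl k V p x ⊗ₜ[k] incl k V q y) = incl k V (p + q) z :=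
    ⟨shMul k V p q (x ⊗ₜ[k] y), by simp [mulMap, mulBil]⟩
  refine eq_zero_of_shuffleChar fun X => ?_
  rw [hz, euler1, DirectSum.toModule_lof]
  simp only [LinearMap.sum_apply, LinearMap.smul_apply, LinearMap.comp_apply, map_sum, map_smul]
  have h0 {r : ℕ} (hr : r ≠ 0) (x : TPow k V r) :
      shuffleChar X (convPow k V (J k V) 0 (incl k V r x)) = 0 := by
    obtain ⟨r, rfl⟩ := Nat.exists_eq_succ_of_ne_zero hr
    simp [convPow, oneEps, counit]
  refine sum_linear_coeff_eq_zero
    (a := fun j => shuffleChar X (convPow k V (J k V) j (incl k V p x)))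
    (b := fun j => shuffleChar X (convPow k V (J k V) j (incl k V q y)))
    (h0 hp x) (h0 hq y) fun n => ?_
  rw [← shuffleChar_flatten_replicate_incl X n le_rfl, ←
    shuffleChar_flatten_replicate_incl X n (by omega), ←
    shuffleChar_flatten_replicate_incl X n (by omega), ← hz, shuffleChar_mulMap]

theorem euler1_mulMap [CharZero k] {x y : TMod k V} (hx : x ∈ augIdeal k V)
    (hy : y ∈ augIdeal k V) : euler1 k V (mulMap k V (x ⊗ₜ[k] y)) = 0 := by
  induction hx using Submodule.iSup_induction' with
  | mem p x hx =>
    obtain ⟨x, rfl⟩ := hx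
    induction hy using Submodule.iSup_induction' with
    | mem q y hy =>
      obtain ⟨y, rfl⟩ := hy
      exact euler1_mulMap_incl p.succ_ne_zero q.succ_ne_zero x y
    | zero => simp
    | add y y' _ _ hy hy' => rw [TensorProduct.tmul_add, map_add, map_add, hy, hy', add_zero]
  | zero => simp
  | add x x' _ _ hx hx' => rw [TensorProduct.add_tmul, map_add, map_add, hx, hx', add_zero]

end ShuffleCharacter

end ShuffleAlgebra

variable {k A} in
theorem euler1C_mulC {x y : HChains k A} (hx : x ∈ augIdealC k A) (hy : y ∈ augIdealC k A) :
    euler1C k A (mulC k A (x ⊗ₜ[k] y)) = 0 := by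
  obtain ⟨x, rfl⟩ := hx
  obtain ⟨y, rfl⟩ := hy
  induction x with
  | zero => rw [map_zero, TensorProduct.zero_tmul, LinearMap.map_zero, LinearMap.map_zero]
  | add x x' hx hx' => rw [map_add, TensorProduct.add_tmul, map_add, map_add, hx, hx', add_zero]
  | tmul a u =>
    induction y with
    | zero => rw [map_zero, TensorProduct.tmul_zero, LinearMap.map_zero, LinearMap.map_zero]
    | add y y' hy hy' => rw [map_add, TensorProduct.tmul_add, map_add, map_add, hy, hy', add_zero]
    | tmul b v => simp [mulC, euler1C, euler1_mulMap u.2 v.2]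

theorem euler1_kills_shuffle_products_of_augmentation_ideal :
    (∀ x ∈ augIdealC k A, ∀ y ∈ augIdealC k A,
      euler1C k A (mulC k A (x ⊗ₜ[k] y)) = 0) ∧
    augIdealCSq k A ≤ LinearMap.ker (euler1C k A) := by
  refine ⟨fun x hx y hy => euler1C_mulC hx hy, Submodule.span_le.mpr ?_⟩
  rintro _ ⟨x, hx, y, hy, rfl⟩
  exact euler1C_mulC hx hy

end
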